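/- There exist absolute constants C, c > 0 such that the following holds. Let G be a regular weighted graph on vertex set V = [n] with normalized adjacency matrix A (symmetric and doubly stochastic), let X₁, …, Xₙ be jointly distributed random variables with values in [k] = {1, …, k} on a finite probability space, let ε ∈ (0,1), and let r be a positive integer with r ≥ C·(k/ε⁴)·rank_{≥ c·ε²/k²}(G). Define jointly distributed random variables X′₁, …, X′ₙ (the output of propagation sampling) as follows: sample m uniformly at random from {1, …, r}; sample S = (s₁, …, s_m) ∈ V^m uniformly at random; sample x_S from the joint distribution of (X_{s₁}, …, X_{s_m}); then, independently for each i ∈ V, sample X′_i from the conditional distribution of X_i given (X_{s₁}, …, X_{s_m}) = x_S. Then E_{ij∼G} ‖{(X_i, X_j)} − {(X′_i, X′_j)}‖₁ ≤ ε. -/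

import Mathlib

open Finset

noncomputable section

variable {Ω : Type*} [Fintype Ω]

/-- Probability of the event `E` under the weight function `p`. -/
def pProb (p : Ω → ℝ) (E : Ω → Prop) [DecidablePred E] : ℝ := ∑ ω, if E ω then p ω else 0

/-- Conditional probability `Pr[E | F]` (defined as `0` if `Pr[F] = 0`). -/
def pCondProb (p : Ω → ℝ) (E F : Ω → Prop) [DecidablePred E] [DecidablePred F] : ℝ :=
  pProb p (fun ω => E ω ∧ F ω) / pProb p F

/-- The number of eigenvalues of a Hermitian (symmetric real) matrix that are
at least `τ`, counted with multiplicity. -/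
def rankGe {n : ℕ} {A : Matrix (Fin n) (Fin n) ℝ} (hA : A.IsHermitian) (τ : ℝ) : ℕ :=
  (Finset.univ.filter (fun r => τ ≤ hA.eigenvalues r)).card

/-- `Pr[(X'_i, X'_j) = (a, b)]` for the output `X'` of propagation sampling with `r`
rounds: choose `m ∈ {1, …, r}` uniformly, a seed tuple `S ∈ V^m` uniformly, an assignment
`x_S` for the seed from the joint law of `X_S`, and then, independently for each vertex,
a label from the conditional distribution given `X_S = x_S`. -/
def propPair {n k : ℕ} (p : Ω → ℝ) (X : Fin n → Ω → Fin k) (r : ℕ)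
    (i j : Fin n) (a b : Fin k) : ℝ :=
  (1 / (r : ℝ)) * ∑ m ∈ Finset.Icc 1 r,
    (1 / (n : ℝ) ^ m) * ∑ S : Fin m → Fin n, ∑ xS : Fin m → Fin k,
      pProb p (fun ω => ∀ t, X (S t) ω = xS t) *
        (pCondProb p (fun ω => X i ω = a) (fun ω => ∀ t, X (S t) ω = xS t) *
          pCondProb p (fun ω => X j ω = b) (fun ω => ∀ t, X (S t) ω = xS t))

theorem quad_le {n : ℕ} (A : Matrix (Fin n) (Fin n) ℝ) (hA : A.IsHermitian)
    (h0 : ∀ i j, 0 ≤ A i j) (h1 : ∀ i, ∑ j, A i j = 1) (h : Fin n → ℝ) :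
    ∑ i, ∑ j, A i j * (h i * h j) ≤ ∑ i, h i ^ 2 := by
  have hs : ∀ i j, A i j = A j i := fun i j => by
    have := hA.apply i j; simpa using this.symm
  have e1 : ∑ i, ∑ j, A i j * h i ^ 2 = ∑ i, h i ^ 2 := by
    refine sum_congr rfl fun i _ => ?_
    rw [← sum_mul, h1, one_mul]
  have e2 : ∑ i, ∑ j, A i j * h j ^ 2 = ∑ i, h i ^ 2 := by
    rw [sum_comm, ← e1]
    refine sum_congr rfl fun i _ => sum_congr rfl fun j _ => ?_
    rw [hs]
  have : ∑ i, ∑ j, A i j * (h i * h j) ≤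
      ∑ i, ∑ j, (A i j * h i ^ 2 / 2 + A i j * h j ^ 2 / 2) := by
    refine sum_le_sum fun i _ => sum_le_sum fun j _ => ?_
    nlinarith [h0 i j, mul_nonneg (h0 i j) (sq_nonneg (h i - h j))]
  simp only [sum_add_distrib, ← sum_div] at this
  rw [e1, e2] at this
  linarith

theorem spec {n : ℕ} (A : Matrix (Fin n) (Fin n) ℝ) (hA : A.IsHermitian)
    (h0 : ∀ i j, 0 ≤ A i j) (h1 : ∀ i, ∑ j, A i j = 1) (τ : ℝ) (hτ : 0 ≤ τ) :
    ∃ Q : Fin n → Fin n → ℝ,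
      (∀ h : Fin n → ℝ, ∑ i, ∑ j, A i j * (h i * h j) ≤
        τ * ∑ i, h i ^ 2 + ∑ i, ∑ j, Q i j * (h i * h j)) ∧
      (∀ i j, |Q i j| ≤ (Q i i + Q j j) / 2) ∧ (∀ i, 0 ≤ Q i i) ∧
      ∑ i, Q i i = (rankGe hA τ : ℝ) := by
  set l := hA.eigenvalues with hl
  set V : Matrix (Fin n) (Fin n) ℝ := (hA.eigenvectorUnitary : Matrix (Fin n) (Fin n) ℝ) with hV
  have hVV : V * V.transpose = 1 := by
    have := Unitary.coe_mul_star_self hA.eigenvectorUnitary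
    simpa [Matrix.star_eq_conjTranspose] using this
  have hVV' : V.transpose * V = 1 := by
    have := Unitary.coe_star_mul_self hA.eigenvectorUnitary
    simpa [Matrix.star_eq_conjTranspose] using this
  have hAV : A = V * Matrix.diagonal l * V.transpose := by
    have := hA.spectral_theorem
    simpa [Unitary.conjStarAlgAut_apply, Matrix.star_eq_conjTranspose, ← hV, Function.comp_def] using this
  have hAe : ∀ i j, A i j = ∑ r, l r * (V i r * V j r) := by
    intro i j
    conv_lhs => rw [hAV]
    rw [Matrix.mul_apply]
    refine sum_congr rfl fun r _ => ?_
    rw [Matrix.mul_diagonal, Matrix.transpose_apply]; ring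
  have hquad : ∀ (R : Finset (Fin n)) (w : Fin n → ℝ) (h : Fin n → ℝ),
      ∑ i, ∑ j, (∑ r ∈ R, w r * (V i r * V j r)) * (h i * h j)
        = ∑ r ∈ R, w r * (∑ i, V i r * h i) ^ 2 := by
    intro R w h
    have : ∀ r, w r * (∑ i, V i r * h i) ^ 2 =
        ∑ i, ∑ j, w r * (V i r * V j r) * (h i * h j) := by
      intro r
      rw [sq, sum_mul_sum, mul_sum]
      refine sum_congr rfl fun i _ => ?_
      rw [mul_sum]
      refine sum_congr rfl fun j _ => by ring
    simp only [this, sum_mul]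
    conv_rhs => rw [sum_comm]
    refine sum_congr rfl fun i _ => ?_
    rw [sum_comm]
  have hortho : ∀ r, ∑ i, V i r ^ 2 = 1 := by
    intro r
    have := congrFun (congrFun hVV' r) r
    rw [Matrix.mul_apply] at this
    simpa [sq] using this
  have hpars : ∀ h : Fin n → ℝ, ∑ r, (∑ i, V i r * h i) ^ 2 = ∑ i, h i ^ 2 := by
    intro h
    have := hquad univ (fun _ => 1) h
    simp only [one_mul] at this
    rw [← this]
    refine sum_congr rfl fun i _ => ?_
    have : ∀ j, ∑ r, V i r * V j r = if i = j then 1 else 0 := by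
      intro j
      have := congrFun (congrFun hVV i) j
      rw [Matrix.mul_apply, Matrix.one_apply] at this
      simpa using this
    simp [this, sq]
  have hl1 : ∀ r, l r ≤ 1 := by
    intro r
    have h2 := quad_le A hA h0 h1 (fun i => V i r)
    rw [hortho r] at h2
    simp only [hAe] at h2
    rw [hquad univ l] at h2
    have : ∀ s, (∑ i, V i s * V i r) = if s = r then 1 else 0 := by
      intro s
      have := congrFun (congrFun hVV' s) r
      rw [Matrix.mul_apply, Matrix.one_apply] at this
      simpa using this
    simpa [this] using h2
  refine ⟨fun i j => ∑ r ∈ univ.filter (fun r => τ ≤ l r), V i r * V j r, ?_, ?_, ?_, ?_⟩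
  · intro h
    have e1 := hquad univ l h
    have e2 := hquad (univ.filter (fun r => τ ≤ l r)) (fun _ => 1) h
    simp only [one_mul] at e2
    rw [e2]
    simp only [hAe]
    rw [e1, ← hpars h, sum_filter, mul_sum, ← sum_add_distrib]
    refine sum_le_sum fun r _ => ?_
    have hc := sq_nonneg (∑ i, V i r * h i)
    split_ifs with hr
    · nlinarith [hl1 r, mul_nonneg hτ hc]
    · push Not at hr
      nlinarith
  · intro i j
    rw [← sum_add_distrib, sum_div]
    refine (abs_sum_le_sum_abs _ _).trans (sum_le_sum fun r _ => ?_)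
    rw [abs_le]; constructor <;> nlinarith [sq_nonneg (V i r + V j r), sq_nonneg (V i r - V j r)]
  · intro i
    exact sum_nonneg fun r _ => mul_self_nonneg _
  · rw [sum_comm]
    simp only [← sq, hortho]
    simp [rankGe, hl]

section prob

set_option linter.unusedSectionVars false

variable {W : Type} [Fintype W] {n k : ℕ}

def qT (q : W → ℝ) : ℝ := ∑ ω, q ω

def qM (X : Fin n → W → Fin k) (q : W → ℝ) (i : Fin n) (a : Fin k) : ℝ :=
  ∑ ω, if X i ω = a then q ω else 0

def qJ (X : Fin n → W → Fin k) (q : W → ℝ) (i : Fin n) (a : Fin k) (j : Fin n) (b : Fin k) : ℝ :=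
  ∑ ω, if X i ω = a ∧ X j ω = b then q ω else 0

def qC (X : Fin n → W → Fin k) (q : W → ℝ) (i : Fin n) (a : Fin k) (j : Fin n) (b : Fin k) : ℝ :=
  qJ X q i a j b - qM X q i a * qM X q j b / qT q

def qRes (X : Fin n → W → Fin k) (q : W → ℝ) (s : Fin n) (y : Fin k) : W → ℝ :=
  fun ω => if X s ω = y then q ω else 0

/-- the drop in potential when conditioning on vertex j -/
def qD (X : Fin n → W → Fin k) (q : W → ℝ) (i j : Fin n) : ℝ :=
  ∑ a, ∑ b, qC X q i a j b ^ 2 / qM X q j b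

def qPhi (X : Fin n → W → Fin k) (q : W → ℝ) : ℝ :=
  ∑ i, ∑ a, qM X q i a ^ 2 / qT q

theorem qT_res (X : Fin n → W → Fin k) (q : W → ℝ) (s : Fin n) (y : Fin k) :
    qT (qRes X q s y) = qM X q s y := rfl

theorem qM_res (X : Fin n → W → Fin k) (q : W → ℝ) (i : Fin n) (a : Fin k) (s : Fin n) (y : Fin k) :
    qM X (qRes X q s y) i a = qJ X q i a s y := by
  unfold qM qRes qJ
  refine sum_congr rfl fun ω _ => ?_
  rw [ite_and]

theorem qJ_comm (X : Fin n → W → Fin k) (q : W → ℝ) (i : Fin n) (a : Fin k) (s : Fin n) (y : Fin k) :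
    qJ X q i a s y = qJ X q s y i a := by
  unfold qJ
  refine sum_congr rfl fun ω _ => ?_
  simp only [and_comm]

theorem sum_res (X : Fin n → W → Fin k) (q : W → ℝ) (s : Fin n) (ω : W) :
    ∑ y, qRes X q s y ω = q ω := by
  simp [qRes]

theorem sum_qM (X : Fin n → W → Fin k) (q : W → ℝ) (i : Fin n) :
    ∑ a, qM X q i a = qT q := by
  unfold qM qT
  rw [sum_comm]
  simp

theorem sum_qJ (X : Fin n → W → Fin k) (q : W → ℝ) (i : Fin n) (a : Fin k) (s : Fin n) :
    ∑ y, qJ X q i a s y = qM X q i a := by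
  unfold qM qJ
  rw [sum_comm]
  refine sum_congr rfl fun ω _ => ?_
  simp only [ite_and]
  split_ifs <;> simp

theorem sum_qJ_res (X : Fin n → W → Fin k) (q : W → ℝ) (i : Fin n) (a : Fin k) (j : Fin n)
    (b : Fin k) (s : Fin n) :
    ∑ y, qJ X (qRes X q s y) i a j b = qJ X q i a j b := by
  unfold qJ
  rw [sum_comm]
  refine sum_congr rfl fun ω _ => ?_
  split_ifs
  · exact sum_res X q s ω
  · simp

theorem qT_nonneg {q : W → ℝ} (hq : ∀ ω, 0 ≤ q ω) : 0 ≤ qT q := sum_nonneg fun ω _ => hq ω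

theorem qM_nonneg (X : Fin n → W → Fin k) {q : W → ℝ} (hq : ∀ ω, 0 ≤ q ω) (i : Fin n) (a : Fin k) :
    0 ≤ qM X q i a := sum_nonneg fun ω _ => by split_ifs <;> simp [hq]

theorem qJ_nonneg (X : Fin n → W → Fin k) {q : W → ℝ} (hq : ∀ ω, 0 ≤ q ω) (i : Fin n) (a : Fin k)
    (j : Fin n) (b : Fin k) :
    0 ≤ qJ X q i a j b := sum_nonneg fun ω _ => by split_ifs <;> simp [hq]

theorem qJ_le (X : Fin n → W → Fin k) {q : W → ℝ} (hq : ∀ ω, 0 ≤ q ω) (i : Fin n) (a : Fin k)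
    (j : Fin n) (b : Fin k) : qJ X q i a j b ≤ qM X q i a := by
  rw [← sum_qJ X q i a j]
  exact single_le_sum (f := fun b => qJ X q i a j b) (fun b _ => qJ_nonneg X hq i a j b) (mem_univ b)

theorem qJ_le' (X : Fin n → W → Fin k) {q : W → ℝ} (hq : ∀ ω, 0 ≤ q ω) (i : Fin n) (a : Fin k)
    (j : Fin n) (b : Fin k) : qJ X q i a j b ≤ qM X q j b := by
  rw [qJ_comm]; exact qJ_le X hq j b i a

theorem qM_le (X : Fin n → W → Fin k) {q : W → ℝ} (hq : ∀ ω, 0 ≤ q ω) (i : Fin n) (a : Fin k) :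
    qM X q i a ≤ qT q := by
  rw [← sum_qM X q i]
  exact single_le_sum (f := fun b => qM X q i b) (fun b _ => qM_nonneg X hq i b) (mem_univ a)

theorem qC_comm (X : Fin n → W → Fin k) (q : W → ℝ) (i : Fin n) (a : Fin k) (s : Fin n) (y : Fin k) :
    qC X q i a s y = qC X q s y i a := by
  unfold qC
  rw [qJ_comm, mul_comm]

/-- potential step for a pair -/
theorem step_pair (X : Fin n → W → Fin k) {q : W → ℝ} (hq : ∀ ω, 0 ≤ q ω) (i : Fin n) (a : Fin k)
    (s : Fin n) :
    ∑ y, qC X q i a s y ^ 2 / qM X q s y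
      = ∑ y, qJ X q i a s y ^ 2 / qM X q s y - qM X q i a ^ 2 / qT q := by
  have hT := qT_nonneg hq
  rcases hT.eq_or_lt with h0 | hpos
  · have hM : ∀ j b, qM X q j b = 0 := fun j b =>
      le_antisymm (h0 ▸ qM_le X hq j b) (qM_nonneg X hq j b)
    simp [hM]
  · have : ∀ y, qC X q i a s y ^ 2 / qM X q s y = qJ X q i a s y ^ 2 / qM X q s y
        - 2 * (qM X q i a / qT q) * qJ X q i a s y + (qM X q i a / qT q) ^ 2 * qM X q s y := by
      intro y
      rcases (qM_nonneg X hq s y).eq_or_lt with h | h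
      · have hJ : qJ X q i a s y = 0 :=
          le_antisymm (h ▸ qJ_le' X hq i a s y) (qJ_nonneg X hq i a s y)
        simp [← h, hJ]
      · unfold qC
        field_simp
        ring
    simp only [this, sum_add_distrib, sum_sub_distrib, ← mul_sum, sum_qJ, sum_qM]
    field_simp
    ring

theorem step_phi (X : Fin n → W → Fin k) {q : W → ℝ} (hq : ∀ ω, 0 ≤ q ω) :
    ∑ s, ∑ y, qPhi X (qRes X q s y) - n * qPhi X q = ∑ i, ∑ j, qD X q i j := by
  unfold qPhi qD
  simp only [qT_res, qM_res, step_pair X hq, sum_sub_distrib]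
  congr 1
  · conv_rhs => rw [sum_comm]
    refine sum_congr rfl fun s _ => ?_
    rw [sum_comm]
    refine sum_congr rfl fun i _ => ?_
    rw [sum_comm]
  · simp [mul_sum]

theorem phi_nonneg (X : Fin n → W → Fin k) {q : W → ℝ} (hq : ∀ ω, 0 ≤ q ω) : 0 ≤ qPhi X q :=
  sum_nonneg fun _ _ => sum_nonneg fun _ _ => div_nonneg (sq_nonneg _) (qT_nonneg hq)

theorem phi_le (X : Fin n → W → Fin k) {q : W → ℝ} (hq : ∀ ω, 0 ≤ q ω) : qPhi X q ≤ n * qT q := by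
  have : qPhi X q ≤ ∑ i : Fin n, ∑ a, qM X q i a := by
    refine sum_le_sum fun i _ => sum_le_sum fun a _ => ?_
    refine div_le_of_le_mul₀ (qT_nonneg hq) (qM_nonneg X hq i a) ?_
    rw [sq]
    exact mul_le_mul_of_nonneg_left (qM_le X hq i a) (qM_nonneg X hq i a)
  simpa [sum_qM] using this

/-! averaging operator -/

def qW (X : Fin n → W → Fin k) (p : W → ℝ) (m : ℕ) (S : Fin m → Fin n) (x : Fin m → Fin k) :
    W → ℝ := fun ω => if ∀ t, X (S t) ω = x t then p ω else 0

def Av (X : Fin n → W → Fin k) (p : W → ℝ) (m : ℕ) (Ψ : (W → ℝ) → ℝ) : ℝ :=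
  (1 / (n : ℝ) ^ m) * ∑ S : Fin m → Fin n, ∑ x : Fin m → Fin k, Ψ (qW X p m S x)

theorem qW_nonneg (X : Fin n → W → Fin k) {p : W → ℝ} (hp : ∀ ω, 0 ≤ p ω) (m : ℕ)
    (S : Fin m → Fin n) (x : Fin m → Fin k) (ω : W) : 0 ≤ qW X p m S x ω := by
  unfold qW; split_ifs <;> simp [hp]

theorem qW_cons (X : Fin n → W → Fin k) (p : W → ℝ) (m : ℕ)
    (S : Fin m → Fin n) (x : Fin m → Fin k) (s : Fin n) (y : Fin k) :
    qW X p (m + 1) (Fin.cons s S) (Fin.cons y x) = qRes X (qW X p m S x) s y := by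
  funext ω
  unfold qW qRes
  simp only [Fin.forall_fin_succ, Fin.cons_zero, Fin.cons_succ, ite_and]

theorem sum_fcons {m : ℕ} {α : Type} [Fintype α] (f : (Fin (m + 1) → α) → ℝ) :
    ∑ S, f S = ∑ S : Fin m → α, ∑ s, f (Fin.cons s S) := by
  rw [← (Fin.consEquiv (fun _ : Fin (m + 1) => α)).sum_comp, Fintype.sum_prod_type, sum_comm]
  rfl

theorem Av_succ (X : Fin n → W → Fin k) (p : W → ℝ) (m : ℕ) (Ψ : (W → ℝ) → ℝ) :
    Av X p (m + 1) Ψ = Av X p m (fun q => (1 / (n : ℝ)) * ∑ s, ∑ y, Ψ (qRes X q s y)) := by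
  unfold Av
  rw [sum_fcons]
  simp only [sum_fcons, ← qW_cons, mul_sum]
  refine sum_congr rfl fun S _ => ?_
  rw [sum_comm]
  refine sum_congr rfl fun x _ => ?_
  refine sum_congr rfl fun s _ => sum_congr rfl fun y _ => ?_
  rw [pow_succ]
  ring

theorem Av_zero (X : Fin n → W → Fin k) (p : W → ℝ) (Ψ : (W → ℝ) → ℝ) : Av X p 0 Ψ = Ψ p := by
  unfold Av
  have : ∀ S x, qW X p 0 S x = p := by
    intro S x; funext ω; simp [qW]
  simp [this]

theorem Av_mono (X : Fin n → W → Fin k) {p : W → ℝ} (hp : ∀ ω, 0 ≤ p ω) (m : ℕ)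
    {Ψ Ψ' : (W → ℝ) → ℝ} (h : ∀ q, (∀ ω, 0 ≤ q ω) → Ψ q ≤ Ψ' q) : Av X p m Ψ ≤ Av X p m Ψ' := by
  unfold Av
  refine mul_le_mul_of_nonneg_left ?_ (by positivity)
  exact sum_le_sum fun S _ => sum_le_sum fun x _ => h _ (qW_nonneg X hp m S x)

theorem Av_congr (X : Fin n → W → Fin k) {p : W → ℝ} (hp : ∀ ω, 0 ≤ p ω) (m : ℕ)
    {Ψ Ψ' : (W → ℝ) → ℝ} (h : ∀ q, (∀ ω, 0 ≤ q ω) → Ψ q = Ψ' q) : Av X p m Ψ = Av X p m Ψ' :=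
  le_antisymm (Av_mono X hp m fun q hq => (h q hq).le) (Av_mono X hp m fun q hq => (h q hq).ge)

theorem Av_add (X : Fin n → W → Fin k) (p : W → ℝ) (m : ℕ) (Ψ Ψ' : (W → ℝ) → ℝ) :
    Av X p m (fun q => Ψ q + Ψ' q) = Av X p m Ψ + Av X p m Ψ' := by
  unfold Av
  simp only [sum_add_distrib, mul_add]

theorem Av_sub (X : Fin n → W → Fin k) (p : W → ℝ) (m : ℕ) (Ψ Ψ' : (W → ℝ) → ℝ) :
    Av X p m (fun q => Ψ q - Ψ' q) = Av X p m Ψ - Av X p m Ψ' := by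
  unfold Av
  simp only [sum_sub_distrib, mul_sub]

theorem Av_mul (X : Fin n → W → Fin k) (p : W → ℝ) (m : ℕ) (c : ℝ) (Ψ : (W → ℝ) → ℝ) :
    Av X p m (fun q => c * Ψ q) = c * Av X p m Ψ := by
  unfold Av
  simp only [← mul_sum]
  ring

theorem Av_sum {ι : Type} (I : Finset ι) (X : Fin n → W → Fin k) (p : W → ℝ) (m : ℕ)
    (Ψ : ι → (W → ℝ) → ℝ) :
    Av X p m (fun q => ∑ i ∈ I, Ψ i q) = ∑ i ∈ I, Av X p m (Ψ i) := by
  unfold Av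
  rw [← mul_sum]
  congr 1
  conv_rhs => rw [sum_comm]
  refine sum_congr rfl fun S _ => ?_
  conv_rhs => rw [sum_comm]

theorem Av_abs (X : Fin n → W → Fin k) (p : W → ℝ) (m : ℕ) (Ψ : (W → ℝ) → ℝ) :
    |Av X p m Ψ| ≤ Av X p m (fun q => |Ψ q|) := by
  unfold Av
  rw [abs_mul, abs_of_nonneg (by positivity : (0 : ℝ) ≤ 1 / (n : ℝ) ^ m)]
  refine mul_le_mul_of_nonneg_left ?_ (by positivity)
  exact (abs_sum_le_sum_abs _ _).trans (sum_le_sum fun S _ => abs_sum_le_sum_abs _ _)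

theorem Av_T (hn : 0 < n) (X : Fin n → W → Fin k) (p : W → ℝ) (m : ℕ) : Av X p m qT = qT p := by
  have hn' : (n : ℝ) ≠ 0 := by positivity
  induction m with
  | zero => exact Av_zero X p _
  | succ m ih =>
    rw [Av_succ, ← ih]
    congr 1
    funext q
    simp only [qT_res, sum_qM]
    simp [hn']

theorem Av_J (hn : 0 < n) (X : Fin n → W → Fin k) (p : W → ℝ) (m : ℕ) (i : Fin n) (a : Fin k)
    (j : Fin n) (b : Fin k) : Av X p m (fun q => qJ X q i a j b) = qJ X p i a j b := by
  have hn' : (n : ℝ) ≠ 0 := by positivity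
  induction m with
  | zero => exact Av_zero X p _
  | succ m ih =>
    rw [Av_succ, ← ih]
    congr 1
    funext q
    simp only [sum_qJ_res]
    simp [hn']

theorem Av_phi (hn : 0 < n) (X : Fin n → W → Fin k) {p : W → ℝ} (hp : ∀ ω, 0 ≤ p ω) (m : ℕ) :
    Av X p m (fun q => ∑ i, ∑ j, qD X q i j)
      = n * (Av X p (m + 1) (qPhi X) - Av X p m (qPhi X)) := by
  have hn' : (n : ℝ) ≠ 0 := by positivity
  rw [Av_succ, ← Av_sub, ← Av_mul]
  refine Av_congr X hp m fun q hq => ?_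
  rw [← step_phi X hq]
  field_simp

theorem sum_Av_D (hn : 0 < n) (X : Fin n → W → Fin k) {p : W → ℝ} (hp : ∀ ω, 0 ≤ p ω)
    (hp1 : ∑ ω, p ω = 1) (r : ℕ) :
    ∑ m ∈ Icc 1 r, Av X p m (fun q => ∑ i, ∑ j, qD X q i j) ≤ (n : ℝ) ^ 2 := by
  have h1 : ∀ r : ℕ, ∑ m ∈ Icc 1 r, Av X p m (fun q => ∑ i, ∑ j, qD X q i j)
      = n * (Av X p (r + 1) (qPhi X) - Av X p 1 (qPhi X)) := by
    intro r
    induction r with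
    | zero => simp
    | succ r ih =>
      rw [sum_Icc_succ_top (by omega), ih, Av_phi hn X hp]
      ring
  rw [h1]
  have h2 : Av X p (r + 1) (qPhi X) ≤ n := by
    have := Av_mono X hp (r + 1) (Ψ := qPhi X) (Ψ' := fun q => n * qT q) fun q hq => phi_le X hq
    rw [Av_mul, Av_T hn] at this
    unfold qT at this
    rw [hp1, mul_one] at this
    exact this
  have h3 : 0 ≤ Av X p 1 (qPhi X) := by
    have := Av_mono X hp 1 (Ψ := fun _ => 0) (Ψ' := qPhi X) fun q hq => phi_nonneg X hq
    simpa [Av] using this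
  have : (0 : ℝ) ≤ n := by positivity
  nlinarith

theorem sum_abs_C (X : Fin n → W → Fin k) {q : W → ℝ} (hq : ∀ ω, 0 ≤ q ω) (i j : Fin n) :
    ∑ a, ∑ b, |qC X q i a j b| ≤ 2 * qT q := by
  have hT := qT_nonneg hq
  have : ∑ a, ∑ b, |qC X q i a j b| ≤
      ∑ a, ∑ b, (qJ X q i a j b + qM X q i a * qM X q j b / qT q) := by
    refine sum_le_sum fun a _ => sum_le_sum fun b _ => ?_
    unfold qC
    refine (abs_sub _ _).trans ?_
    rw [abs_of_nonneg (qJ_nonneg X hq i a j b), abs_of_nonneg (div_nonneg (mul_nonneg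
      (qM_nonneg X hq i a) (qM_nonneg X hq j b)) hT)]
  refine this.trans (le_of_eq ?_)
  simp only [sum_add_distrib, sum_qJ, sum_qM, ← sum_div, ← mul_sum, ← sum_mul]
  rcases hT.eq_or_lt with h0 | hpos
  · simp [← h0]
  · field_simp
    ring

theorem abs_C_le (X : Fin n → W → Fin k) {q : W → ℝ} (hq : ∀ ω, 0 ≤ q ω) (i : Fin n) (a : Fin k)
    (j : Fin n) (b : Fin k) :
    |qC X q i a j b| ≤ √(qM X q i a) * √(qM X q j b) := by
  have hT := qT_nonneg hq
  have ha := qM_nonneg X hq i a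
  have hb := qM_nonneg X hq j b
  have hJ := qJ_nonneg X hq i a j b
  have h1 : qJ X q i a j b ≤ √(qM X q i a) * √(qM X q j b) := by
    rw [← Real.sqrt_mul ha]
    refine Real.le_sqrt_of_sq_le ?_
    rw [sq]
    exact mul_le_mul (qJ_le X hq i a j b) (qJ_le' X hq i a j b) hJ ha
  have h2 : qM X q i a * qM X q j b / qT q ≤ √(qM X q i a) * √(qM X q j b) := by
    rw [← Real.sqrt_mul ha]
    refine div_le_of_le_mul₀ hT (Real.sqrt_nonneg _) ?_
    have h3 : √(qM X q i a * qM X q j b) ≤ qT q := by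
      rw [Real.sqrt_le_left hT, sq]
      exact mul_le_mul (qM_le X hq i a) (qM_le X hq j b) hb hT
    have h4 := Real.mul_self_sqrt (mul_nonneg ha hb)
    nlinarith [Real.sqrt_nonneg (qM X q i a * qM X q j b)]
  have h5 : 0 ≤ qM X q i a * qM X q j b / qT q := div_nonneg (mul_nonneg ha hb) hT
  unfold qC
  rw [abs_le]
  constructor <;> linarith

def qK (X : Fin n → W → Fin k) (q : W → ℝ) (i j : Fin n) : ℝ :=
  ∑ a, ∑ b, qC X q i a j b ^ 2 / (√(qM X q i a) * √(qM X q j b))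

theorem qK_nonneg (X : Fin n → W → Fin k) (q : W → ℝ) (i j : Fin n) : 0 ≤ qK X q i j :=
  sum_nonneg fun _ _ => sum_nonneg fun _ _ => by positivity

theorem qK_le (X : Fin n → W → Fin k) {q : W → ℝ} (hq : ∀ ω, 0 ≤ q ω) (i j : Fin n) :
    qK X q i j ≤ 2 * qT q := by
  refine le_trans ?_ (sum_abs_C X hq i j)
  refine sum_le_sum fun a _ => sum_le_sum fun b _ => ?_
  refine div_le_of_le_mul₀ (by positivity) (abs_nonneg _) ?_
  rw [← sq_abs, sq]
  exact mul_le_mul_of_nonneg_left (abs_C_le X hq i a j b) (abs_nonneg _)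

theorem C_term_le (X : Fin n → W → Fin k) {q : W → ℝ} (hq : ∀ ω, 0 ≤ q ω) (i : Fin n) (a : Fin k)
    (j : Fin n) (b : Fin k) :
    qC X q i a j b ^ 2 / (√(qM X q i a) * √(qM X q j b)) ≤
      (qC X q j b i a ^ 2 / qM X q i a + qC X q i a j b ^ 2 / qM X q j b) / 2 := by
  have hc := abs_C_le X hq i a j b
  rw [qC_comm X q j b i a]
  have ea := Real.sq_sqrt (qM_nonneg X hq i a)
  have eb := Real.sq_sqrt (qM_nonneg X hq j b)
  generalize qC X q i a j b = c at *
  rw [← ea, ← eb, Real.sqrt_sq (Real.sqrt_nonneg _), Real.sqrt_sq (Real.sqrt_nonneg _)]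
  rcases (Real.sqrt_nonneg (qM X q i a)).eq_or_lt with h | h
  · rw [← h] at hc
    have : c = 0 := by simpa using hc
    simp [this]
  rcases (Real.sqrt_nonneg (qM X q j b)).eq_or_lt with h' | h'
  · rw [← h'] at hc
    have : c = 0 := by simpa using hc
    simp [this]
  generalize √(qM X q i a) = x at *
  generalize √(qM X q j b) = y at *
  have : (c ^ 2 / x ^ 2 + c ^ 2 / y ^ 2) / 2 - c ^ 2 / (x * y) = (c / x - c / y) ^ 2 / 2 := by
    field_simp
    ring
  nlinarith [sq_nonneg (c / x - c / y)]

theorem sum_K_le (X : Fin n → W → Fin k) {q : W → ℝ} (hq : ∀ ω, 0 ≤ q ω) :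
    ∑ i, ∑ j, qK X q i j ≤ ∑ i, ∑ j, qD X q i j := by
  have h1 : ∀ i j, qK X q i j ≤ (qD X q j i + qD X q i j) / 2 := by
    intro i j
    have : qK X q i j ≤ ∑ a, ∑ b,
      (qC X q j b i a ^ 2 / qM X q i a + qC X q i a j b ^ 2 / qM X q j b) / 2 :=
      sum_le_sum fun a _ => sum_le_sum fun b _ => C_term_le X hq i a j b
    refine this.trans (le_of_eq ?_)
    simp only [← sum_div, sum_add_distrib]
    unfold qD
    congr 2
    rw [sum_comm]
    simp only [sum_div]
  have h2 : ∑ i, ∑ j, qK X q i j ≤ ∑ i, ∑ j, (qD X q j i + qD X q i j) / 2 :=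
    sum_le_sum fun i _ => sum_le_sum fun j _ => h1 i j
  refine h2.trans (le_of_eq ?_)
  simp only [← sum_div, sum_add_distrib]
  rw [sum_comm]
  ring

theorem L1_le (X : Fin n → W → Fin k) {q : W → ℝ} (hq : ∀ ω, 0 ≤ q ω) (i j : Fin n) (s : ℝ)
    (hs : 0 < s) :
    ∑ a, ∑ b, |qC X q i a j b| ≤ s / 2 * (k * qT q) + qK X q i j / (2 * s) := by
  have h1 : ∀ a b, |qC X q i a j b| ≤ s / 2 * ((qM X q i a + qM X q j b) / 2)
      + qC X q i a j b ^ 2 / (√(qM X q i a) * √(qM X q j b)) / (2 * s) := by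
    intro a b
    have hc := abs_C_le X hq i a j b
    have ea := Real.sq_sqrt (qM_nonneg X hq i a)
    have eb := Real.sq_sqrt (qM_nonneg X hq j b)
    have hx := Real.sqrt_nonneg (qM X q i a)
    have hy := Real.sqrt_nonneg (qM X q j b)
    rw [← sq_abs (qC X q i a j b)]
    have hc0 := abs_nonneg (qC X q i a j b)
    generalize |qC X q i a j b| = c at *
    have h2 : √(qM X q i a) * √(qM X q j b) ≤ (qM X q i a + qM X q j b) / 2 := by
      nlinarith [sq_nonneg (√(qM X q i a) - √(qM X q j b))]
    have h3 : c ≤ s / 2 * (√(qM X q i a) * √(qM X q j b))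
        + c ^ 2 / (√(qM X q i a) * √(qM X q j b)) / (2 * s) := by
      rcases (mul_nonneg hx hy).eq_or_lt with h | h
      · rw [← h] at hc ⊢
        simpa using hc
      · generalize √(qM X q i a) * √(qM X q j b) = z at *
        have : s / 2 * z + c ^ 2 / z / (2 * s) - c = (s * z - c) ^ 2 / (2 * s * z) := by
          field_simp
          ring
        have : 0 ≤ (s * z - c) ^ 2 / (2 * s * z) := by positivity
        linarith
    nlinarith
  refine (sum_le_sum fun a _ => sum_le_sum fun b _ => h1 a b).trans (le_of_eq ?_)
  simp only [sum_add_distrib, ← sum_div, ← mul_sum, sum_qM]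
  simp only [sum_const, card_univ, Fintype.card_fin, nsmul_eq_mul, ← mul_sum, sum_qM]
  unfold qK
  ring

def qf (X : Fin n → W → Fin k) (q : W → ℝ) (i : Fin n) (a : Fin k) (ω : W) : ℝ :=
  (if X i ω = a then 1 else 0) - qM X q i a / qT q

def qh (X : Fin n → W → Fin k) (q : W → ℝ) (i : Fin n) (ω ω' : W) : ℝ :=
  ∑ a, qf X q i a ω * qf X q i a ω' / √(qM X q i a)

theorem C_eq (X : Fin n → W → Fin k) {q : W → ℝ} (hT : qT q ≠ 0) (i : Fin n) (a : Fin k)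
    (j : Fin n) (b : Fin k) :
    qC X q i a j b = ∑ ω, q ω * (qf X q i a ω * qf X q j b ω) := by
  have : ∀ ω, q ω * (qf X q i a ω * qf X q j b ω) =
      (if X i ω = a ∧ X j ω = b then q ω else 0)
      - (qM X q j b / qT q) * (if X i ω = a then q ω else 0)
      - (qM X q i a / qT q) * (if X j ω = b then q ω else 0)
      + (qM X q i a / qT q) * (qM X q j b / qT q) * q ω := by
    intro ω
    unfold qf
    by_cases h1 : X i ω = a <;> by_cases h2 : X j ω = b <;> simp [h1, h2] <;> ring
  simp only [this, sum_add_distrib, sum_sub_distrib, ← mul_sum]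
  change _ = qJ X q i a j b - qM X q j b / qT q * qM X q i a
    - qM X q i a / qT q * qM X q j b + qM X q i a / qT q * (qM X q j b / qT q) * qT q
  unfold qC
  field_simp
  ring

theorem sum_comm4 {α β : Type} [Fintype α] [Fintype β] (f : α → α → β → β → ℝ) :
    ∑ i, ∑ j, ∑ x, ∑ y, f i j x y = ∑ x, ∑ y, ∑ i, ∑ j, f i j x y := by
  calc _ = ∑ u : α × α, ∑ v : β × β, f u.1 u.2 v.1 v.2 := by
        simp only [Fintype.sum_prod_type]
    _ = ∑ v : β × β, ∑ u : α × α, f u.1 u.2 v.1 v.2 := sum_comm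
    _ = _ := by simp only [Fintype.sum_prod_type]

theorem K_eq (X : Fin n → W → Fin k) {q : W → ℝ} (hT : qT q ≠ 0) (i j : Fin n) :
    qK X q i j = ∑ ω, ∑ ω', q ω * q ω' * (qh X q i ω ω' * qh X q j ω ω') := by
  have h1 : ∀ a b, qC X q i a j b ^ 2 / (√(qM X q i a) * √(qM X q j b)) =
      ∑ ω, ∑ ω', q ω * q ω' * ((qf X q i a ω * qf X q i a ω' / √(qM X q i a)) *
        (qf X q j b ω * qf X q j b ω' / √(qM X q j b))) := by
    intro a b
    rw [C_eq X hT, sq, sum_mul_sum, sum_div]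
    refine sum_congr rfl fun ω _ => ?_
    rw [sum_div]
    refine sum_congr rfl fun ω' _ => ?_
    ring
  have h2 : ∀ ω ω', q ω * q ω' * (qh X q i ω ω' * qh X q j ω ω') = ∑ a, ∑ b,
      q ω * q ω' * ((qf X q i a ω * qf X q i a ω' / √(qM X q i a)) *
        (qf X q j b ω * qf X q j b ω' / √(qM X q j b))) := by
    intro ω ω'
    unfold qh
    rw [sum_mul_sum, mul_sum]
    refine sum_congr rfl fun a _ => ?_
    rw [mul_sum]
  unfold qK
  simp only [h1, h2]
  rw [sum_comm4]

theorem K_quad (X : Fin n → W → Fin k) {q : W → ℝ} (hT : qT q ≠ 0) (B : Fin n → Fin n → ℝ)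
    (g : Fin n → ℝ) :
    ∑ i, ∑ j, B i j * (g i * g j * qK X q i j) =
      ∑ ω, ∑ ω', q ω * q ω' * ∑ i, ∑ j, B i j * ((g i * qh X q i ω ω') * (g j * qh X q j ω ω')) := by
  simp only [K_eq X hT, mul_sum]
  rw [sum_comm4]
  refine sum_congr rfl fun _ _ => sum_congr rfl fun _ _ => sum_congr rfl fun _ _ =>
    sum_congr rfl fun _ _ => ?_
  ring

theorem K_diag (X : Fin n → W → Fin k) {q : W → ℝ} (hT : qT q ≠ 0) (τ : ℝ)
    (g : Fin n → ℝ) :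
    τ * ∑ i, g i ^ 2 * qK X q i i =
      ∑ ω, ∑ ω', q ω * q ω' * (τ * ∑ i, (g i * qh X q i ω ω') ^ 2) := by
  simp only [K_eq X hT, mul_sum]
  rw [sum_comm]
  refine sum_congr rfl fun _ _ => ?_
  rw [sum_comm]
  refine sum_congr rfl fun _ _ => sum_congr rfl fun _ _ => ?_
  ring

theorem K_spec (X : Fin n → W → Fin k) {q : W → ℝ} (hq : ∀ ω, 0 ≤ q ω) (hT : qT q ≠ 0)
    (A : Matrix (Fin n) (Fin n) ℝ) (Q : Fin n → Fin n → ℝ) (τ : ℝ)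
    (hQ : ∀ h : Fin n → ℝ, ∑ i, ∑ j, A i j * (h i * h j) ≤
        τ * ∑ i, h i ^ 2 + ∑ i, ∑ j, Q i j * (h i * h j))
    (g : Fin n → ℝ) :
    ∑ i, ∑ j, A i j * (g i * g j * qK X q i j) ≤
      τ * ∑ i, g i ^ 2 * qK X q i i + ∑ i, ∑ j, Q i j * (g i * g j * qK X q i j) := by
  rw [K_quad X hT (fun i j => A i j), K_quad X hT Q, K_diag X hT]
  simp only [← sum_add_distrib, ← mul_add]
  refine sum_le_sum fun ω _ => sum_le_sum fun ω' _ => ?_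
  exact mul_le_mul_of_nonneg_left (hQ _) (mul_nonneg (hq _) (hq _))

theorem local_bound (hn : 0 < n) (hk : 0 < k) (X : Fin n → W → Fin k) {q : W → ℝ}
    (hq : ∀ ω, 0 ≤ q ω)
    (A : Matrix (Fin n) (Fin n) ℝ) (hs : ∀ i j, A i j = A j i) (h0 : ∀ i j, 0 ≤ A i j)
    (h1 : ∀ i, ∑ j, A i j = 1) (Q : Fin n → Fin n → ℝ) (τ ε R : ℝ) (hε : 0 < ε) (hτ0 : 0 ≤ τ)
    (hτ : τ * (8 * k) ≤ ε ^ 2) (hR : 0 ≤ R)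
    (hQ : ∀ h : Fin n → ℝ, ∑ i, ∑ j, A i j * (h i * h j) ≤
        τ * ∑ i, h i ^ 2 + ∑ i, ∑ j, Q i j * (h i * h j))
    (hQ1 : ∀ i j, |Q i j| ≤ (Q i i + Q j j) / 2) (hQ0 : ∀ i, 0 ≤ Q i i)
    (hQR : ∑ i, Q i i = R) :
    ∑ i, ∑ j, A i j * ∑ a, ∑ b, |qC X q i a j b| ≤
      n * (7 * ε / 8) * qT q + (8 * k * R / (ε ^ 2 * n)) * ∑ i, ∑ j, qD X q i j := by
  have hT := qT_nonneg hq
  have hn' : (0 : ℝ) < n := by positivity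
  have hk' : (0 : ℝ) < k := by positivity
  have hKD := sum_K_le X hq
  rcases hT.eq_or_lt with hT0 | hTpos
  · have hz : ∀ i j, ∑ a, ∑ b, |qC X q i a j b| = 0 := fun i j =>
      le_antisymm (by have := sum_abs_C X hq i j; rw [← hT0] at this; simpa using this)
        (sum_nonneg fun _ _ => sum_nonneg fun _ _ => abs_nonneg _)
    have hD : 0 ≤ ∑ i, ∑ j, qD X q i j :=
      le_trans (sum_nonneg fun i _ => sum_nonneg fun j _ => qK_nonneg X q i j) hKD
    simp only [hz, ← hT0]
    simp only [mul_zero, sum_const_zero, zero_add]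
    positivity
  -- bad vertices
  set Bd : Finset (Fin n) := univ.filter (fun i => 16 * R < ε * n * Q i i) with hBd
  have hcard : 16 * (Bd.card : ℝ) ≤ ε * n := by
    have h2 : (Bd.card : ℝ) * (16 * R) ≤ ε * n * R := by
      calc (Bd.card : ℝ) * (16 * R) = ∑ i ∈ Bd, 16 * R := by simp
        _ ≤ ∑ i ∈ Bd, ε * n * Q i i :=
          sum_le_sum fun i hi => (mem_filter.1 hi).2.le
        _ ≤ ∑ i, ε * n * Q i i := sum_le_sum_of_subset_of_nonneg (filter_subset _ _)
          fun i _ _ => mul_nonneg (by positivity) (hQ0 i)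
        _ = ε * n * R := by rw [← mul_sum, hQR]
    rcases hR.eq_or_lt with hR0 | hRpos
    · have h3 : ∀ i, Q i i = 0 := by
        intro i
        have := single_le_sum (f := fun i => Q i i) (fun i _ => hQ0 i) (mem_univ i)
        rw [hQR, ← hR0] at this
        exact le_antisymm this (hQ0 i)
      have : Bd = ∅ := by
        rw [hBd, filter_eq_empty_iff]
        intro i _
        simp [h3, ← hR0]
      rw [this]
      simp only [card_empty, Nat.cast_zero, mul_zero]
      positivity
    · refine le_of_mul_le_mul_right ?_ hRpos
      linarith
  set g : Fin n → ℝ := fun i => if i ∈ Bd then 0 else 1 with hg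
  have hg01 : ∀ i, 0 ≤ g i ∧ g i ≤ 1 := by
    intro i; simp only [hg]; split_ifs <;> norm_num
  have hgsum : ∑ i, (1 - g i) = Bd.card := by
    have : ∀ i, 1 - g i = if i ∈ Bd then 1 else 0 := by
      intro i; simp only [hg]; split_ifs <;> norm_num
    simp [this]
  -- pointwise bound
  have hpt : ∀ i j, ∑ a, ∑ b, |qC X q i a j b| ≤
      (1 - g i) * (2 * qT q) + (1 - g j) * (2 * qT q) + ε / 2 * qT q
        + k / (2 * ε) * (g i * g j * qK X q i j) := by
    intro i j
    have e1 := sum_abs_C X hq i j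
    have e2 := L1_le X hq i j (ε / k) (by positivity)
    have e3 := qK_nonneg X q i j
    have e4 : ε / k / 2 * (k * qT q) + qK X q i j / (2 * (ε / k)) =
      ε / 2 * qT q + k / (2 * ε) * qK X q i j := by
      field_simp
    rw [e4] at e2
    have e5 : 0 ≤ ε / 2 * qT q := by positivity
    have e6 : 0 ≤ k / (2 * ε) * qK X q i j := by positivity
    simp only [hg]
    split_ifs <;> simp only [sub_zero, sub_self, zero_mul, mul_zero, one_mul, mul_one, add_zero,
      zero_add] <;> linarith
  have hcol : ∀ j, ∑ i, A i j = 1 := fun j => by simp only [fun i => hs i j, h1]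
  have hbad1 : ∑ i, ∑ j, A i j * ((1 - g i) * (2 * qT q)) = Bd.card * (2 * qT q) := by
    simp only [← sum_mul, h1, one_mul, hgsum]
  have hbad2 : ∑ i, ∑ j, A i j * ((1 - g j) * (2 * qT q)) = Bd.card * (2 * qT q) := by
    rw [sum_comm]
    simp only [← sum_mul, hcol, one_mul, hgsum]
  have hmid : ∑ i, ∑ j, A i j * (ε / 2 * qT q) = n * (ε / 2 * qT q) := by
    simp only [← sum_mul, h1]
    simp
  have htot : ∑ i, ∑ j, A i j * ∑ a, ∑ b, |qC X q i a j b| ≤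
      Bd.card * (2 * qT q) + Bd.card * (2 * qT q) + n * (ε / 2 * qT q)
        + k / (2 * ε) * ∑ i, ∑ j, A i j * (g i * g j * qK X q i j) := by
    have : ∑ i, ∑ j, A i j * ∑ a, ∑ b, |qC X q i a j b| ≤ ∑ i, ∑ j,
        (A i j * ((1 - g i) * (2 * qT q)) + A i j * ((1 - g j) * (2 * qT q))
        + A i j * (ε / 2 * qT q) + k / (2 * ε) * (A i j * (g i * g j * qK X q i j))) := by
      refine sum_le_sum fun i _ => sum_le_sum fun j _ => ?_
      refine (mul_le_mul_of_nonneg_left (hpt i j) (h0 i j)).trans (le_of_eq ?_)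
      ring
    refine this.trans (le_of_eq ?_)
    simp only [sum_add_distrib, hbad1, hbad2, hmid, ← mul_sum]
  have hsp := K_spec X hq hTpos.ne' A Q τ hQ g
  have hdiag : ∑ i, g i ^ 2 * qK X q i i ≤ n * (2 * qT q) := by
    have : ∑ i, g i ^ 2 * qK X q i i ≤ ∑ i : Fin n, 2 * qT q := by
      refine sum_le_sum fun i _ => ?_
      have e1 := qK_le X hq i i
      have e3 := qK_nonneg X q i i
      have := hg01 i
      have : g i ^ 2 ≤ 1 := by nlinarith
      nlinarith
    simpa using this
  have hoff : ∑ i, ∑ j, Q i j * (g i * g j * qK X q i j) ≤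
      16 * R / (ε * n) * ∑ i, ∑ j, qD X q i j := by
    refine le_trans ?_ (mul_le_mul_of_nonneg_left hKD (by positivity))
    simp only [mul_sum]
    refine sum_le_sum fun i _ => sum_le_sum fun j _ => ?_
    have e3 := qK_nonneg X q i j
    have hz : 0 ≤ 16 * R / (ε * n) * qK X q i j := by positivity
    by_cases hi : i ∈ Bd
    · simpa [hg, hi] using hz
    by_cases hj : j ∈ Bd
    · simpa [hg, hj] using hz
    have hgi : g i = 1 := by simp [hg, hi]
    have hgj : g j = 1 := by simp [hg, hj]
    rw [hgi, hgj, one_mul, one_mul]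
    refine mul_le_mul_of_nonneg_right ?_ e3
    have bi : ε * n * Q i i ≤ 16 * R := by simpa [hBd] using hi
    have bj : ε * n * Q j j ≤ 16 * R := by simpa [hBd] using hj
    have := (le_abs_self _).trans (hQ1 i j)
    rw [le_div_iff₀ (by positivity)]
    nlinarith [mul_pos hε hn']
  have hfin : k / (2 * ε) * ∑ i, ∑ j, A i j * (g i * g j * qK X q i j) ≤
      n * (ε / 8) * qT q + (8 * k * R / (ε ^ 2 * n)) * ∑ i, ∑ j, qD X q i j := by
    have h3 : ∑ i, ∑ j, A i j * (g i * g j * qK X q i j) ≤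
        τ * (n * (2 * qT q)) + 16 * R / (ε * n) * ∑ i, ∑ j, qD X q i j :=
      hsp.trans (add_le_add (mul_le_mul_of_nonneg_left hdiag hτ0) hoff)
    refine (mul_le_mul_of_nonneg_left h3 (by positivity)).trans ?_
    rw [mul_add]
    refine add_le_add ?_ (le_of_eq ?_)
    · have : k / (2 * ε) * (τ * (n * (2 * qT q))) = (τ * (8 * k)) / (8 * ε) * (n * qT q) := by
        field_simp
      rw [this]
      have h4 : (τ * (8 * k)) / (8 * ε) ≤ ε / 8 := by
        rw [div_le_iff₀ (by positivity)]
        nlinarith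
      have := mul_le_mul_of_nonneg_right h4 (by positivity : 0 ≤ n * qT q)
      linarith
    · field_simp
      ring
  have hB : (Bd.card : ℝ) * (2 * qT q) ≤ ε * n / 16 * (2 * qT q) :=
    mul_le_mul_of_nonneg_right (by linarith) (by positivity)
  linarith

end prob

/-- **propagation sampling.** There are absolute constants `C, c > 0` such
that, for a regular weighted graph `G` with normalized adjacency matrix `A`, jointly
distributed `[k]`-valued `X₁, …, Xₙ`, `ε ∈ (0,1)` and a number of rounds
`r ≥ C (k/ε⁴) rank_{≥ c ε²/k²}(G)`, the output `X'` of propagation sampling satisfies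
`E_{ij∼G} ‖{(X_i, X_j)} − {(X'_i, X'_j)}‖₁ ≤ ε`. -/
theorem stmt_8 :
    ∃ C c : ℝ, 0 < C ∧ 0 < c ∧
      ∀ (n : ℕ), 0 < n →
      ∀ (A : Matrix (Fin n) (Fin n) ℝ) (hA : A.IsHermitian),
        (∀ i j, 0 ≤ A i j) → (∀ i, ∑ j, A i j = 1) →
      ∀ (Ω : Type) (_ : Fintype Ω) (p : Ω → ℝ),
        (∀ ω, 0 ≤ p ω) → (∑ ω, p ω = 1) →
      ∀ (k : ℕ), 0 < k →
      ∀ (X : Fin n → Ω → Fin k) (ε : ℝ), 0 < ε → ε < 1 →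
      ∀ (r : ℕ), 0 < r →
        C * ((k : ℝ) / ε ^ 4) * (rankGe hA (c * ε ^ 2 / (k : ℝ) ^ 2) : ℝ) ≤ (r : ℝ) →
        (1 / (n : ℝ)) * ∑ i, ∑ j, A i j *
            ∑ a : Fin k, ∑ b : Fin k,
              |pProb p (fun ω => X i ω = a ∧ X j ω = b) - propPair p X r i j a b| ≤ ε := by
  refine ⟨64, 1 / 8, by norm_num, by norm_num, ?_⟩
  intro n hn A hA h0 h1 Ω _ p hp hp1 k hk X ε hε hε1 r hr hrC
  have hn' : (0 : ℝ) < n := by positivity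
  have hk' : (1 : ℝ) ≤ k := by exact_mod_cast hk
  have hr' : (0 : ℝ) < r := by positivity
  set τ : ℝ := 1 / 8 * ε ^ 2 / (k : ℝ) ^ 2 with hτd
  have hτ0 : 0 ≤ τ := by positivity
  have hτ : τ * (8 * k) ≤ ε ^ 2 := by
    have : τ * (8 * k) = ε ^ 2 / k := by
      rw [hτd]; field_simp
    rw [this]
    exact div_le_self (by positivity) hk'
  have hs : ∀ i j, A i j = A j i := fun i j => by
    have := hA.apply i j; simpa using this.symm
  obtain ⟨Q, hQ, hQ1, hQ0, hQR⟩ := spec A hA h0 h1 τ hτ0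
  set R : ℝ := (rankGe hA τ : ℝ) with hRd
  have hR : 0 ≤ R := by positivity
  have hterm : ∀ i j a b, pProb p (fun ω => X i ω = a ∧ X j ω = b) - propPair p X r i j a b =
      (1 / (r : ℝ)) * ∑ m ∈ Icc 1 r, Av X p m (fun q => qC X q i a j b) := by
    intro i j a b
    have e1 : ∀ m, Av X p m (fun q => qC X q i a j b) = qJ X p i a j b -
        Av X p m (fun q => qM X q i a * qM X q j b / qT q) := by
      intro m
      rw [← Av_J hn X p m, ← Av_sub]
      rfl
    have e2 : propPair p X r i j a b = (1 / (r : ℝ)) * ∑ m ∈ Icc 1 r,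
        Av X p m (fun q => qM X q i a * qM X q j b / qT q) := by
      unfold propPair Av
      congr 1
      refine sum_congr rfl fun m _ => ?_
      congr 1
      refine sum_congr rfl fun S _ => sum_congr rfl fun x _ => ?_
      have f1 : pProb p (fun ω => ∀ t, X (S t) ω = x t) = qT (qW X p m S x) := rfl
      have f2 : ∀ i a, pProb p (fun ω => X i ω = a ∧ ∀ t, X (S t) ω = x t) =
          qM X (qW X p m S x) i a := by
        intro i a
        unfold pProb qM qW
        refine sum_congr rfl fun ω _ => ?_
        simp only [ite_and]
      unfold pCondProb
      rw [f1, f2, f2]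
      by_cases hz : qT (qW X p m S x) = 0
      · simp [hz]
      · field_simp
    have e3 : pProb p (fun ω => X i ω = a ∧ X j ω = b) = qJ X p i a j b := rfl
    rw [e2, e3]
    simp only [e1, sum_sub_distrib, sum_const, Nat.card_Icc, nsmul_eq_mul]
    simp only [Nat.add_sub_cancel]
    field_simp
  have habs : ∀ i j a b, |pProb p (fun ω => X i ω = a ∧ X j ω = b) - propPair p X r i j a b| ≤
      (1 / (r : ℝ)) * ∑ m ∈ Icc 1 r, Av X p m (fun q => |qC X q i a j b|) := by
    intro i j a b
    rw [hterm, abs_mul, abs_of_nonneg (by positivity : (0 : ℝ) ≤ 1 / (r : ℝ))]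
    refine mul_le_mul_of_nonneg_left ?_ (by positivity)
    exact (abs_sum_le_sum_abs _ _).trans (sum_le_sum fun m _ => Av_abs X p m _)
  have hsum : ∑ i, ∑ j, A i j * ∑ a : Fin k, ∑ b : Fin k,
      |pProb p (fun ω => X i ω = a ∧ X j ω = b) - propPair p X r i j a b| ≤
      (1 / (r : ℝ)) * ∑ m ∈ Icc 1 r,
        Av X p m (fun q => ∑ i, ∑ j, A i j * ∑ a, ∑ b, |qC X q i a j b|) := by
    have e4 : (1 / (r : ℝ)) * ∑ m ∈ Icc 1 r,
        Av X p m (fun q => ∑ i, ∑ j, A i j * ∑ a, ∑ b, |qC X q i a j b|) =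
        ∑ i, ∑ j, A i j * ∑ a, ∑ b, (1 / (r : ℝ)) * ∑ m ∈ Icc 1 r,
          Av X p m (fun q => |qC X q i a j b|) := by
      simp only [Av_sum, Av_mul]
      rw [sum_comm, mul_sum]
      refine sum_congr rfl fun i _ => ?_
      rw [sum_comm, mul_sum]
      refine sum_congr rfl fun j _ => ?_
      rw [← mul_sum, mul_left_comm]
      congr 1
      rw [sum_comm, mul_sum]
      refine sum_congr rfl fun a _ => ?_
      rw [sum_comm, mul_sum]
    rw [e4]
    refine sum_le_sum fun i _ => sum_le_sum fun j _ => mul_le_mul_of_nonneg_left ?_ (h0 i j)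
    exact sum_le_sum fun a _ => sum_le_sum fun b _ => habs i j a b
  have hm : ∀ m, Av X p m (fun q => ∑ i, ∑ j, A i j * ∑ a, ∑ b, |qC X q i a j b|) ≤
      n * (7 * ε / 8) + (8 * k * R / (ε ^ 2 * n)) *
        Av X p m (fun q => ∑ i, ∑ j, qD X q i j) := by
    intro m
    have := Av_mono X hp m (fun q hq => local_bound hn hk X hq A hs h0 h1 Q τ ε R hε hτ0 hτ hR
      hQ hQ1 hQ0 hQR)
    refine this.trans (le_of_eq ?_)
    rw [Av_add, Av_mul, Av_mul, Av_T hn]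
    unfold qT
    rw [hp1, mul_one]
  have hD := sum_Av_D hn X hp hp1 r
  have hall : ∑ m ∈ Icc 1 r,
        Av X p m (fun q => ∑ i, ∑ j, A i j * ∑ a, ∑ b, |qC X q i a j b|) ≤
      r * (n * (7 * ε / 8)) + (8 * k * R / (ε ^ 2 * n)) * (n : ℝ) ^ 2 := by
    refine (sum_le_sum fun m _ => hm m).trans ?_
    rw [sum_add_distrib]
    refine add_le_add (le_of_eq ?_) ?_
    · simp only [sum_const, Nat.card_Icc, nsmul_eq_mul, Nat.add_sub_cancel]
    · have hk0 : (0 : ℝ) ≤ k := by linarith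
      rw [← mul_sum]
      exact mul_le_mul_of_nonneg_left hD
        (div_nonneg (mul_nonneg (by linarith) hR) (by positivity))
  have hlast : 8 * k * R / ε ^ 2 ≤ r * (ε / 8) := by
    have e5 : 8 * k * R / ε ^ 2 = ε ^ 2 / 8 * (64 * (k / ε ^ 4) * R) := by
      field_simp
      ring
    rw [e5]
    have e6 : ε ^ 2 / 8 * (64 * (k / ε ^ 4) * R) ≤ ε ^ 2 / 8 * r :=
      mul_le_mul_of_nonneg_left hrC (by positivity)
    have e7 : ε ^ 2 ≤ ε := by nlinarith
    nlinarith
  calc _ ≤ (1 / (n : ℝ)) * ((1 / (r : ℝ)) * (r * (n * (7 * ε / 8)) +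
        (8 * k * R / (ε ^ 2 * n)) * (n : ℝ) ^ 2)) := by
        refine mul_le_mul_of_nonneg_left (hsum.trans ?_) (by positivity)
        exact mul_le_mul_of_nonneg_left hall (by positivity)
    _ = 7 * ε / 8 + (1 / (r : ℝ)) * (8 * k * R / ε ^ 2) := by
        field_simp
    _ ≤ 7 * ε / 8 + (1 / (r : ℝ)) * (r * (ε / 8)) := by
        gcongr
    _ = ε := by
        field_simp
        ring

end
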